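/- For every positive natural number n there exists a constant C > 0, depending only on n, such that for every R > 0 there exists a smooth compactly supported function η : ℝⁿ → ℝ with: (i) the support of η is contained in the open ball of radius R centered at the origin; (ii) 0 ≤ η(x) ≤ 1 for all x; (iii) η(x) = 1 for all x with ‖x‖ ≤ R/2; (iv) ‖∇η(x)‖ ≤ (C/R) · η(x)^{1/2} for all x ∈ ℝⁿ; and (v) Δη(x) ≥ -C/R² for all x ∈ ℝⁿ. -/

import Mathlib

open MeasureTheory Real
open scoped BigOperators RealInnerProductSpace

noncomputable section

/-- The Euclidean Laplacian `Δf(x) = Σᵢ ∂²f/∂xᵢ²(x)` of `f : ℝⁿ → ℝ`. -/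
def lap {n : ℕ} (f : EuclideanSpace ℝ (Fin n) → ℝ) (x : EuclideanSpace ℝ (Fin n)) : ℝ :=
  ∑ i : Fin n,
    fderiv ℝ (fun y => fderiv ℝ f y (EuclideanSpace.single i 1)) x (EuclideanSpace.single i 1)

lemma exists_abs_lap_le {n : ℕ} {φ : EuclideanSpace ℝ (Fin n) → ℝ}
    (hφ : ContDiff ℝ 2 φ) (hc : HasCompactSupport φ) : ∃ B : ℝ, ∀ x, |lap φ x| ≤ B := by
  have hpartial (i : Fin n) : ∃ B : ℝ, ∀ x,
      ‖fderiv ℝ (fun y => fderiv ℝ φ y (EuclideanSpace.single i 1)) x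
        (EuclideanSpace.single i 1)‖ ≤ B := by
    have hd : ContDiff ℝ 1 (fun y => fderiv ℝ φ y (EuclideanSpace.single i 1)) :=
      (hφ.fderiv_right (m := 1) (by norm_num)).clm_apply contDiff_const
    exact ((hc.fderiv_apply (𝕜 := ℝ) _).fderiv_apply (𝕜 := ℝ) _).exists_bound_of_continuous
      ((hd.continuous_fderiv one_ne_zero).clm_apply continuous_const)
  choose B hB using hpartial
  exact ⟨∑ i, B i, fun x => (Finset.abs_sum_le_sum_abs _ _).trans
    (Finset.sum_le_sum fun i _ => hB i x)⟩

lemma lap_comp_smul {n : ℕ} (φ : EuclideanSpace ℝ (Fin n) → ℝ) (c : ℝ)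
    (x : EuclideanSpace ℝ (Fin n)) :
    lap (fun y => φ (c • y)) x = c ^ 2 * lap φ (c • x) := by
  simp only [lap, Finset.mul_sum]
  refine Finset.sum_congr rfl fun i _ => ?_
  simp only [fderiv_comp_smul, smul_apply]
  change fderiv ℝ (c • fun y => fderiv ℝ φ (c • y) (EuclideanSpace.single i 1)) x _ = _
  rw [fderiv_const_smul_field, Pi.smul_apply,
    fderiv_comp_smul (f := fun y => fderiv ℝ φ y (EuclideanSpace.single i 1))]
  simp only [smul_apply, smul_eq_mul]
  ring

lemma norm_gradient_eq_norm_fderiv {E : Type*} [NormedAddCommGroup E] [InnerProductSpace ℝ E]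
    [CompleteSpace E] (f : E → ℝ) (x : E) : ‖gradient f x‖ = ‖fderiv ℝ f x‖ := by
  simp [gradient]

/-- the cut-off function lemma (paper's Lemma 5).
For each dimension `n` there is a constant `C > 0` (depending only on `n`) such that for
every `R > 0` there is a smooth compactly supported cutoff `η` supported in `B_R`, with
`0 ≤ η ≤ 1`, `η ≡ 1` on `B_{R/2}`, `‖∇η‖ ≤ (C/R) √η` and `Δη ≥ -C/R²`. -/
theorem cutoff_function_exists (n : ℕ) (hn : 0 < n) :
    ∃ C : ℝ, 0 < C ∧ ∀ R : ℝ, 0 < R →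
      ∃ η : EuclideanSpace ℝ (Fin n) → ℝ,
        ContDiff ℝ (⊤ : ℕ∞) η ∧ HasCompactSupport η ∧
        tsupport η ⊆ Metric.ball (0 : EuclideanSpace ℝ (Fin n)) R ∧
        (∀ x, 0 ≤ η x ∧ η x ≤ 1) ∧
        (∀ x, ‖x‖ ≤ R / 2 → η x = 1) ∧
        (∀ x, ‖gradient η x‖ ≤ C / R * Real.sqrt (η x)) ∧
        (∀ x, -(C / R ^ 2) ≤ lap η x) := by
  let f : ContDiffBump (0 : EuclideanSpace ℝ (Fin n)) := ⟨1 / 2, 3 / 4, by norm_num, by norm_num⟩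
  have hf {m : ℕ∞} : ContDiff ℝ m f := f.contDiff
  have hsq {m : ℕ∞} : ContDiff ℝ m (fun x => f x ^ 2) := hf.pow 2
  have hcs : HasCompactSupport (fun x => f x ^ 2) :=
    f.hasCompactSupport.comp_left (g := fun t : ℝ => t ^ 2) (by simp)
  obtain ⟨K, hK⟩ := (f.hasCompactSupport.fderiv (𝕜 := ℝ)).exists_bound_of_continuous
    (hf.continuous_fderiv (n := (1 : ℕ∞)) (by simp))
  obtain ⟨B, hB⟩ := exists_abs_lap_le (hsq (m := 2)) hcs
  have hK0 : 0 ≤ K := (norm_nonneg _).trans (hK 0)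
  have hB0 : 0 ≤ B := (abs_nonneg _).trans (hB 0)
  refine ⟨2 * K + B + 1, by positivity, fun R hR => ⟨fun x => f (R⁻¹ • x) ^ 2, ?_, ?_, ?_, ?_, ?_,
    ?_, ?_⟩⟩
  · exact hsq.comp (contDiff_const_smul _)
  · exact hcs.comp_smul (inv_ne_zero hR.ne')
  · have hclosed : tsupport (fun x => f (R⁻¹ • x) ^ 2) ⊆ Metric.closedBall 0 (3 / 4 * R) := by
      refine closure_minimal (fun x hx => ?_) Metric.isClosed_closedBall
      by_contra hfar
      refine hx ?_
      have hzero : f (R⁻¹ • x) = 0 := f.zero_of_le_dist <| by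
        rw [mem_closedBall_zero_iff, not_le] at hfar
        rw [dist_zero_right, norm_smul, norm_inv, Real.norm_of_nonneg hR.le, inv_mul_eq_div,
          le_div_iff₀ hR]
        exact hfar.le
      simp [hzero]
    exact hclosed.trans (Metric.closedBall_subset_ball (by linarith))
  · exact fun x => ⟨sq_nonneg _, pow_le_one₀ f.nonneg f.le_one⟩
  · intro x hx
    have hone : f (R⁻¹ • x) = 1 := f.one_of_mem_closedBall <| by
      rw [mem_closedBall_zero_iff, norm_smul, norm_inv, Real.norm_of_nonneg hR.le, inv_mul_eq_div,
        div_le_iff₀ hR]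
      change ‖x‖ ≤ 1 / 2 * R
      linarith
    simp [hone]
  · intro x
    have hd : DifferentiableAt ℝ f (R⁻¹ • x) :=
      (hf (m := 1)).differentiable (by simp) _
    rw [norm_gradient_eq_norm_fderiv, fderiv_comp_smul (f := fun y => f y ^ 2),
      fderiv_fun_pow 2 hd, Real.sqrt_sq f.nonneg, norm_smul, norm_smul, norm_inv,
      Real.norm_of_nonneg hR.le, div_eq_inv_mul, mul_assoc]
    refine mul_le_mul_of_nonneg_left ?_ (inv_nonneg.2 hR.le)
    have hf0 : 0 ≤ f (R⁻¹ • x) := f.nonneg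
    have hnorm : ‖2 • f (R⁻¹ • x) ^ (2 - 1)‖ = 2 * f (R⁻¹ • x) := by
      simp [abs_of_nonneg hf0]
    rw [hnorm]
    nlinarith [mul_le_mul_of_nonneg_left (hK (R⁻¹ • x)) hf0, mul_nonneg hB0 hf0]
  · intro x
    rw [lap_comp_smul (fun y => f y ^ 2), inv_pow, div_eq_inv_mul, ← mul_neg]
    gcongr
    linarith [neg_le_of_abs_le (hB (R⁻¹ • x))]
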